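/- arXiv:2308.07087 — 5 statements merged into one kernel-verified Lean document; each statement's English description precedes it below -/
import Mathlib

section
/- Let E, J, R, Q ∈ ℝ^{n×n}, B, P ∈ ℝ^{n×m}, S ∈ ℝ^{m×m} be real matrices and let T be a non-singular real n×n matrix with Q = T Tᵀ. Define J̃ = Tᵀ J T, R̃ = Tᵀ R T, Ẽ = Tᵀ E T⁻ᵀ, P̃ = Tᵀ P. Then: (i) if J is skew-symmetric, so is J̃; (ii) Ẽᵀ = T⁻¹ (Eᵀ Q) T⁻ᵀ, and consequently Ẽ is symmetric positive semi-definite if and only if Eᵀ Q is symmetric positive semi-definite (likewise for positive definiteness); (iii) if the (n+m)×(n+m) block matrix W = [[Qᵀ R Q, Qᵀ P], [Pᵀ Q, S]] is symmetric positive semi-definite, then the block matrix W̃ = [[R̃, P̃], [P̃ᵀ, S]] is symmetric positive semi-definite. -/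
open Matrix

/-- Lemma 2 (structure part): the basis transformation with `Q = T Tᵀ`
preserves the pH structure: skew-symmetry of `J`, (semi-)definiteness of the
mass matrix, and positive semi-definiteness of the block matrix `W`. -/
theorem basis_transformation_preserves_pH_structure {n m : ℕ}
    (E J R Q : Matrix (Fin n) (Fin n) ℝ)
    (B P : Matrix (Fin n) (Fin m) ℝ)
    (S : Matrix (Fin m) (Fin m) ℝ)
    (T : Matrix (Fin n) (Fin n) ℝ) (hT : IsUnit T.det)
    (hQ : Q = T * Tᵀ) :
    (Jᵀ = -J → (Tᵀ * J * T)ᵀ = -(Tᵀ * J * T)) ∧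
    ((Tᵀ * E * (Tᵀ)⁻¹)ᵀ = T⁻¹ * (Eᵀ * Q) * (Tᵀ)⁻¹) ∧
    ((Tᵀ * E * (Tᵀ)⁻¹).PosSemidef ↔ (Eᵀ * Q).PosSemidef) ∧
    ((Tᵀ * E * (Tᵀ)⁻¹).PosDef ↔ (Eᵀ * Q).PosDef) ∧
    ((Matrix.fromBlocks (Qᵀ * R * Q) (Qᵀ * P) (Pᵀ * Q) S).PosSemidef →
      (Matrix.fromBlocks (Tᵀ * R * T) (Tᵀ * P) ((Tᵀ * P)ᵀ) S).PosSemidef) := by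
  have hTt : IsUnit (Tᵀ).det := by rwa [Matrix.det_transpose]
  have h2 : (Tᵀ * E * (Tᵀ)⁻¹)ᵀ = T⁻¹ * (Eᵀ * Q) * (Tᵀ)⁻¹ := by
    have h : T * Tᵀ * (Tᵀ)⁻¹ = T := Matrix.mul_nonsing_inv_cancel_right _ _ hTt
    rw [Matrix.transpose_mul, Matrix.transpose_mul, Matrix.transpose_nonsing_inv,
      Matrix.transpose_transpose, hQ, Matrix.mul_assoc T⁻¹, Matrix.mul_assoc Eᵀ, h]
  have hU : IsUnit T⁻¹ := by
    rw [Matrix.isUnit_nonsing_inv_iff, Matrix.isUnit_iff_isUnit_det]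
    exact hT
  have hs : star (T⁻¹) = (Tᵀ)⁻¹ := by
    rw [Matrix.star_eq_conjTranspose, Matrix.conjTranspose_eq_transpose_of_trivial,
      Matrix.transpose_nonsing_inv]
  refine ⟨?_, h2, ?_, ?_, ?_⟩
  · intro hJ
    simp [Matrix.transpose_mul, hJ, Matrix.mul_assoc]
  · rw [← Matrix.posSemidef_transpose_iff, h2, ← hs]
    exact Matrix.IsUnit.posSemidef_star_right_conjugate_iff hU
  · rw [← Matrix.PosDef.transpose_iff, h2, ← hs]
    exact Matrix.IsUnit.posDef_star_right_conjugate_iff hU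
  · intro hW
    have h := hW.conjTranspose_mul_mul_same
      (Matrix.fromBlocks (Tᵀ)⁻¹ 0 0 (1 : Matrix (Fin m) (Fin m) ℝ))
    convert h using 1
    have a1 : T⁻¹ * T = 1 := Matrix.nonsing_inv_mul _ hT
    have a2 : Tᵀ * (Tᵀ)⁻¹ = 1 := Matrix.mul_nonsing_inv _ hTt
    have a3 : ∀ {k : ℕ} (X : Matrix (Fin n) (Fin k) ℝ), T⁻¹ * (T * X) = X := fun X => by
      rw [← Matrix.mul_assoc, a1, Matrix.one_mul]
    simp [Matrix.conjTranspose_eq_transpose_of_trivial, Matrix.fromBlocks_transpose,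
      Matrix.fromBlocks_multiply, Matrix.transpose_nonsing_inv, hQ, Matrix.mul_assoc, a2, a3,
      Matrix.transpose_mul]
end

section
/- Let (M, 𝒜, μ) be a measure space with probability measure μ, let Φ₁, …, Φ_s : M → ℝ be measurable functions, and let A : M → ℝ^{n×n} be a measurable matrix-valued function such that for all i, j ∈ {1,…,s} and all k, ℓ ∈ {1,…,n} the function p ↦ a_{kℓ}(p) Φ_i(p) Φ_j(p) is integrable. Define the block matrix ∈ ℝ^{ns×ns} with blocks Â_{ij} ∈ ℝ^{n×n} given entrywise by (Â_{ij})_{kℓ} = ∫_M a_{kℓ}(p) Φ_i(p) Φ_j(p) dμ(p). If A(p) is symmetric positive semi-definite for μ-almost every p ∈ M, then is symmetric positive semi-definite. -/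
open Matrix MeasureTheory

/-- Lemma 5 (semi-definite case): the stochastic Galerkin projection of an
almost everywhere symmetric positive semi-definite matrix-valued function is
symmetric positive semi-definite. -/
theorem sg_projection_posSemidef {M : Type*} [MeasurableSpace M]
    (μ : Measure M) [IsProbabilityMeasure μ]
    (n s : ℕ)
    (Φ : Fin s → M → ℝ) (hΦ : ∀ i, Measurable (Φ i))
    (A : M → Matrix (Fin n) (Fin n) ℝ)
    (hAmeas : ∀ k l, Measurable fun p => A p k l)
    (hint : ∀ (i j : Fin s) (k l : Fin n),
      Integrable (fun p => A p k l * Φ i p * Φ j p) μ)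
    (Ahat : Matrix (Fin s × Fin n) (Fin s × Fin n) ℝ)
    (hAhat : ∀ (i j : Fin s) (k l : Fin n),
      Ahat (i, k) (j, l) = ∫ p, A p k l * Φ i p * Φ j p ∂μ)
    (hpsd : ∀ᵐ p ∂μ, (A p).PosSemidef) :
    Ahat.PosSemidef := by
  refine Matrix.PosSemidef.of_dotProduct_mulVec_nonneg ?_ ?_
  · ext ⟨i, k⟩ ⟨j, l⟩
    rw [Matrix.conjTranspose_apply, hAhat, hAhat, star_trivial]
    refine integral_congr_ae ?_
    filter_upwards [hpsd] with p hp
    have h := hp.1.apply k l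
    rw [star_trivial] at h
    rw [h]
    ring
  · intro x
    have key : star x ⬝ᵥ (Ahat *ᵥ x) = ∫ p, ∑ a : Fin s × Fin n, ∑ b : Fin s × Fin n,
        x a * x b * (A p a.2 b.2 * Φ a.1 p * Φ b.1 p) ∂μ := by
      rw [integral_finsetSum _ fun a _ => integrable_finsetSum _ fun b _ =>
        (hint a.1 b.1 a.2 b.2).const_mul _]
      simp only [dotProduct, mulVec, star_trivial, Finset.mul_sum]
      refine Finset.sum_congr rfl fun a _ => ?_
      rw [integral_finsetSum _ fun b _ => (hint a.1 b.1 a.2 b.2).const_mul _]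
      refine Finset.sum_congr rfl fun b _ => ?_
      rw [integral_const_mul, ← hAhat]
      ring
    rw [key]
    refine integral_nonneg_of_ae ?_
    filter_upwards [hpsd] with p hp
    have h := hp.dotProduct_mulVec_nonneg (fun k => ∑ i, x (i, k) * Φ i p)
    refine h.trans_eq ?_
    simp only [dotProduct, mulVec, star_trivial, Fintype.sum_prod_type_right, Finset.mul_sum,
      Finset.sum_mul, Pi.star_apply]
    refine Finset.sum_congr rfl fun k _ => ?_
    symm
    rw [Finset.sum_comm]
    refine Finset.sum_congr rfl fun l _ => ?_
    rw [Finset.sum_comm]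
    refine Finset.sum_congr rfl fun j _ => ?_
    refine Finset.sum_congr rfl fun i _ => ?_
    ring
end

section
/- Let (M, 𝒜, μ) be a measure space with probability measure μ, let Φ₁, …, Φ_s : M → ℝ be measurable functions that are orthonormal in L²(μ), i.e., ∫_M Φ_i Φ_j dμ = δ_{ij}, and let A : M → ℝ^{n×n} be a measurable matrix-valued function such that for all i, j ∈ {1,…,s} and all k, ℓ ∈ {1,…,n} the function p ↦ a_{kℓ}(p) Φ_i(p) Φ_j(p) is integrable. Define the block matrix ∈ ℝ^{ns×ns} with blocks (Â_{ij})_{kℓ} = ∫_M a_{kℓ}(p) Φ_i(p) Φ_j(p) dμ(p). If A(p) is symmetric positive definite for μ-almost every p ∈ M, then is symmetric positive definite. -/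
open Matrix MeasureTheory

/-- Lemma 5 (definite case): with orthonormal basis functions, the stochastic
Galerkin projection of an almost everywhere symmetric positive definite
matrix-valued function is symmetric positive definite. -/
theorem sg_projection_posDef {M : Type*} [MeasurableSpace M]
    (μ : Measure M) [IsProbabilityMeasure μ]
    (n s : ℕ)
    (Φ : Fin s → M → ℝ) (hΦ : ∀ i, Measurable (Φ i))
    (hortho : ∀ i j : Fin s,
      ∫ p, Φ i p * Φ j p ∂μ = if i = j then (1 : ℝ) else 0)
    (A : M → Matrix (Fin n) (Fin n) ℝ)
    (hAmeas : ∀ k l, Measurable fun p => A p k l)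
    (hint : ∀ (i j : Fin s) (k l : Fin n),
      Integrable (fun p => A p k l * Φ i p * Φ j p) μ)
    (Ahat : Matrix (Fin s × Fin n) (Fin s × Fin n) ℝ)
    (hAhat : ∀ (i j : Fin s) (k l : Fin n),
      Ahat (i, k) (j, l) = ∫ p, A p k l * Φ i p * Φ j p ∂μ)
    (hpd : ∀ᵐ p ∂μ, (A p).PosDef) :
    Ahat.PosDef := by
  have hsq : ∀ i, MemLp (Φ i) 2 μ := by
    intro i
    rw [memLp_two_iff_integrable_sq (hΦ i).aestronglyMeasurable]
    by_contra h
    have h1 := hortho i i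
    simp only [← pow_two] at h1
    rw [integral_undef h] at h1
    simp at h1
  have hprod : ∀ i j, Integrable (fun p => Φ i p * Φ j p) μ :=
    fun i j => (hsq i).integrable_mul (hsq j)
  refine PosDef.of_dotProduct_mulVec_pos ?_ ?_
  · ext ⟨i, k⟩ ⟨j, l⟩
    simp only [conjTranspose_apply, hAhat, star_trivial]
    refine integral_congr_ae ?_
    filter_upwards [hpd] with p hp
    have h := hp.1.apply k l
    simp only [star_trivial] at h
    rw [h]; ring
  · intro x hx
    let v : M → Fin n → ℝ := fun p k => ∑ i, x (i, k) * Φ i p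
    let q : M → ℝ := fun p => star (v p) ⬝ᵥ (A p *ᵥ v p)
    have hq : q = fun p => ∑ a : Fin s × Fin n, ∑ b : Fin s × Fin n,
        x a * x b * (A p a.2 b.2 * Φ a.1 p * Φ b.1 p) := by
      funext p
      simp only [q, v, dotProduct, mulVec, star_trivial, Pi.star_apply,
        Fintype.sum_prod_type_right, Finset.sum_mul, Finset.mul_sum]
      refine Finset.sum_congr rfl fun k _ => ?_
      symm
      rw [Finset.sum_comm]
      refine Finset.sum_congr rfl fun l _ => ?_
      rw [Finset.sum_comm]
      refine Finset.sum_congr rfl fun j _ => ?_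
      refine Finset.sum_congr rfl fun i _ => ?_
      ring
    have hqi : Integrable q μ := by
      rw [hq]
      exact integrable_finsetSum _ fun a _ => integrable_finsetSum _ fun b _ =>
        (hint _ _ _ _).const_mul _
    have hqint : star x ⬝ᵥ (Ahat *ᵥ x) = ∫ p, q p ∂μ := by
      rw [hq, integral_finsetSum _ fun a _ => integrable_finsetSum _ fun b _ =>
        (hint _ _ _ _).const_mul _]
      simp only [dotProduct, mulVec, star_trivial, Finset.mul_sum]
      refine Finset.sum_congr rfl fun a _ => ?_
      rw [integral_finsetSum _ fun b _ => (hint _ _ _ _).const_mul _]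
      refine Finset.sum_congr rfl fun b _ => ?_
      rw [integral_const_mul, ← hAhat]
      ring
    have hq0 : 0 ≤ᵐ[μ] q := by
      filter_upwards [hpd] with p hp
      exact hp.posSemidef.dotProduct_mulVec_nonneg _
    rw [hqint]
    refine lt_of_le_of_ne (integral_nonneg_of_ae hq0) fun h => hx ?_
    have hz := (integral_eq_zero_iff_of_nonneg_ae hq0 hqi).1 h.symm
    have hv : ∀ᵐ p ∂μ, v p = 0 := by
      filter_upwards [hpd, hz] with p hp hzp
      by_contra hne
      exact (hp.dotProduct_mulVec_pos hne).ne' hzp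
    funext ⟨j, l⟩
    have h1 : ∫ p, v p l * Φ j p ∂μ = x (j, l) := by
      simp only [v, Finset.sum_mul, mul_assoc]
      rw [integral_finsetSum _ fun i _ => (hprod i j).const_mul _]
      simp [integral_const_mul, hortho]
    rw [← h1]
    refine integral_eq_zero_of_ae ?_
    filter_upwards [hv] with p hp
    simp [hp]
end

section
/- Let (M, 𝒜, μ) be a measure space with probability measure μ, let Φ₁, …, Φ_s : M → ℝ be measurable functions, and let R : M → ℝ^{n×n}, P : M → ℝ^{n×m}, S : M → ℝ^{m×m} be measurable matrix-valued functions whose entries multiplied by Φ_i Φ_j are integrable for all i, j. Let R̂ ∈ ℝ^{ns×ns}, P̂ ∈ ℝ^{ns×ms}, Ŝ ∈ ℝ^{ms×ms} be their stochastic Galerkin projections (block matrices with entries (Â_{ij})_{kℓ} = ∫ a_{kℓ} Φ_i Φ_j dμ for the respective matrix functions). If for μ-almost every p ∈ M the (n+m)×(n+m) block matrix W(p) = [[R(p), P(p)], [P(p)ᵀ, S(p)]] is symmetric positive semi-definite, then the (ns+ms)×(ns+ms) block matrix [[R̂, P̂], [P̂ᵀ, Ŝ]] is symmetric positive semi-definite.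 -/
open Matrix MeasureTheory

theorem posSemidef_of_integral {M : Type*} [MeasurableSpace M] (μ : Measure M)
    {ι : Type*} (G : M → Matrix ι ι ℝ) (A : Matrix ι ι ℝ)
    (hint : ∀ i j, Integrable (fun p => G p i j) μ)
    (hA : ∀ i j, A i j = ∫ p, G p i j ∂μ)
    (hG : ∀ᵐ p ∂μ, (G p).PosSemidef) : A.PosSemidef := by
  refine ⟨?_, fun x => ?_⟩
  · ext i j
    rw [conjTranspose_apply, hA, hA, star_trivial]
    apply integral_congr_ae
    filter_upwards [hG] with p hp
    simpa using hp.1.apply i j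
  · have : (x.sum fun i xi => x.sum fun j xj => star xi * A i j * xj)
        = ∫ p, (x.sum fun i xi => x.sum fun j xj => star xi * G p i j * xj) ∂μ := by
      simp only [Finsupp.sum]
      have h1 : ∀ i j, Integrable (fun p => star (x i) * G p i j * x j) μ :=
        fun i j => ((hint i j).const_mul _).mul_const _
      rw [integral_finset_sum _ fun i _ => integrable_finset_sum _ fun j _ => h1 i j]
      refine Finset.sum_congr rfl fun i _ => ?_
      rw [integral_finset_sum _ fun j _ => h1 i j]
      refine Finset.sum_congr rfl fun j _ => ?_
      rw [integral_mul_const, integral_const_mul, hA]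
    rw [this]
    apply integral_nonneg_of_ae
    filter_upwards [hG] with p hp
    exact hp.2 x

/-- Key step in Theorem 6: if the parameter-dependent pH structure matrix
`W(p) = [[R(p), P(p)], [P(p)ᵀ, S(p)]]` is a.e. symmetric positive
semi-definite, then the block matrix `[[R̂, P̂], [P̂ᵀ, Ŝ]]` built from the
stochastic Galerkin projections is symmetric positive semi-definite. -/
theorem sg_projection_block_posSemidef {M : Type*} [MeasurableSpace M]
    (μ : Measure M) [IsProbabilityMeasure μ]
    (n m s : ℕ)
    (Φ : Fin s → M → ℝ) (hΦ : ∀ i, Measurable (Φ i))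
    (R : M → Matrix (Fin n) (Fin n) ℝ)
    (P : M → Matrix (Fin n) (Fin m) ℝ)
    (S : M → Matrix (Fin m) (Fin m) ℝ)
    (hRmeas : ∀ k l, Measurable fun p => R p k l)
    (hPmeas : ∀ k l, Measurable fun p => P p k l)
    (hSmeas : ∀ k l, Measurable fun p => S p k l)
    (hRint : ∀ (i j : Fin s) (k l : Fin n),
      Integrable (fun p => R p k l * Φ i p * Φ j p) μ)
    (hPint : ∀ (i j : Fin s) (k : Fin n) (l : Fin m),
      Integrable (fun p => P p k l * Φ i p * Φ j p) μ)
    (hSint : ∀ (i j : Fin s) (k l : Fin m),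
      Integrable (fun p => S p k l * Φ i p * Φ j p) μ)
    (Rhat : Matrix (Fin s × Fin n) (Fin s × Fin n) ℝ)
    (Phat : Matrix (Fin s × Fin n) (Fin s × Fin m) ℝ)
    (Shat : Matrix (Fin s × Fin m) (Fin s × Fin m) ℝ)
    (hRhat : ∀ (i j : Fin s) (k l : Fin n),
      Rhat (i, k) (j, l) = ∫ p, R p k l * Φ i p * Φ j p ∂μ)
    (hPhat : ∀ (i j : Fin s) (k : Fin n) (l : Fin m),
      Phat (i, k) (j, l) = ∫ p, P p k l * Φ i p * Φ j p ∂μ)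
    (hShat : ∀ (i j : Fin s) (k l : Fin m),
      Shat (i, k) (j, l) = ∫ p, S p k l * Φ i p * Φ j p ∂μ)
    (hW : ∀ᵐ p ∂μ, (Matrix.fromBlocks (R p) (P p) ((P p)ᵀ) (S p)).PosSemidef) :
    (Matrix.fromBlocks Rhat Phat (Phatᵀ) Shat).PosSemidef := by
  let e : (Fin s × Fin n) ⊕ (Fin s × Fin m) → Fin n ⊕ Fin m := Sum.map Prod.snd Prod.snd
  let f : M → (Fin s × Fin n) ⊕ (Fin s × Fin m) → ℝ :=
    fun p => Sum.elim (fun a => Φ a.1 p) (fun a => Φ a.1 p)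
  have key : ∀ p a b, (fromBlocks (R p) (P p) ((P p)ᵀ) (S p)) (e a) (e b) * f p a * f p b =
      ((diagonal (f p))ᴴ * (fromBlocks (R p) (P p) ((P p)ᵀ) (S p)).submatrix e e
        * diagonal (f p)) a b := by
    intro p a b
    rw [diagonal_conjTranspose, mul_diagonal, diagonal_mul, submatrix_apply]
    simp only [star_trivial]
    ring
  refine posSemidef_of_integral μ
    (fun p => (diagonal (f p))ᴴ * (fromBlocks (R p) (P p) ((P p)ᵀ) (S p)).submatrix e e
        * diagonal (f p)) _ ?_ ?_ ?_
  · intro a b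
    simp only [← key]
    rcases a with ⟨i, k⟩ | ⟨i, k⟩ <;> rcases b with ⟨j, l⟩ | ⟨j, l⟩
    · exact hRint i j k l
    · exact hPint i j k l
    · simpa [e, f, mul_right_comm] using hPint j i l k
    · exact hSint i j k l
  · intro a b
    simp only [← key]
    rcases a with ⟨i, k⟩ | ⟨i, k⟩ <;> rcases b with ⟨j, l⟩ | ⟨j, l⟩
    · exact hRhat i j k l
    · exact hPhat i j k l
    · simpa [e, f, mul_right_comm] using hPhat j i l k
    · exact hShat i j k l
  · filter_upwards [hW] with p hp
    exact (hp.submatrix e).conjTranspose_mul_mul_same _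
end

section
/- Let (M, 𝒜, μ) be a measure space with probability measure μ, let Φ₁, …, Φ_s : M → ℝ be measurable functions, and let E : M → ℝ^{n×n} be a measurable matrix-valued function whose entries multiplied by Φ_i Φ_j are integrable for all i, j ∈ {1,…,s}. Let Ê ∈ ℝ^{ns×ns} be the block matrix with blocks (Ê_{ij})_{kℓ} = ∫_M E(p)_{kℓ} Φ_i(p) Φ_j(p) dμ(p). Then for every v̂ = (v̂₁ᵀ, …, v̂_sᵀ)ᵀ ∈ ℝ^{ns} with v̂_i ∈ ℝⁿ, the Hamiltonian of the SG system satisfies Ĥ(v̂) := (1/2) v̂ᵀ Êᵀ v̂ = ∫_M (1/2) ( Σ_{i=1}^s Φ_i(p) v̂_i )ᵀ E(p)ᵀ ( Σ_{j=1}^s Φ_j(p) v̂_j ) dμ(p); that is, Ĥ(v̂) equals the expected value E[ H( Σ_{j=1}^s v̂_j Φ_j(·), · ) ] of the parameter-dependent Hamiltonian H(x, p) = (1/2) xᵀ E(p)ᵀ x evaluated at the truncated polynomial chaos expansion with coefficients v̂₁, …, v̂_s. -/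
open Matrix MeasureTheory

/-- Theorem 7: the Hamiltonian `Ĥ(v̂) = (1/2) v̂ᵀ Êᵀ v̂` of the stochastic
Galerkin system equals the expected value of the parameter-dependent
Hamiltonian `H(x,p) = (1/2) xᵀ E(p)ᵀ x` evaluated at the truncated polynomial
chaos expansion `Σ_j v̂_j Φ_j`. -/
theorem sg_hamiltonian_is_expected_hamiltonian {M : Type*} [MeasurableSpace M]
    (μ : Measure M) [IsProbabilityMeasure μ]
    (n s : ℕ)
    (Φ : Fin s → M → ℝ) (hΦ : ∀ i, Measurable (Φ i))
    (E : M → Matrix (Fin n) (Fin n) ℝ)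
    (hEmeas : ∀ k l, Measurable fun p => E p k l)
    (hint : ∀ (i j : Fin s) (k l : Fin n),
      Integrable (fun p => E p k l * Φ i p * Φ j p) μ)
    (Ehat : Matrix (Fin s × Fin n) (Fin s × Fin n) ℝ)
    (hEhat : ∀ (i j : Fin s) (k l : Fin n),
      Ehat (i, k) (j, l) = ∫ p, E p k l * Φ i p * Φ j p ∂μ)
    (v : Fin s → Fin n → ℝ) :
    (1 / 2 : ℝ) *
        ((fun ik : Fin s × Fin n => v ik.1 ik.2) ⬝ᵥ
          (Ehatᵀ *ᵥ fun ik : Fin s × Fin n => v ik.1 ik.2)) =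
      ∫ p, (1 / 2 : ℝ) *
        ((fun k => ∑ i, Φ i p * v i k) ⬝ᵥ
          ((E p)ᵀ *ᵥ fun k => ∑ j, Φ j p * v j k)) ∂μ := by
  have key : ∀ p, ((fun k => ∑ i, Φ i p * v i k) ⬝ᵥ
          ((E p)ᵀ *ᵥ fun k => ∑ j, Φ j p * v j k)) =
      ∑ x : Fin s × Fin n, ∑ y : Fin s × Fin n,
        (v x.1 x.2 * v y.1 y.2) * (E p y.2 x.2 * Φ y.1 p * Φ x.1 p) := by
    intro p
    simp only [dotProduct, mulVec, transpose_apply, Fintype.sum_prod_type_right]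
    refine Finset.sum_congr rfl fun k _ => ?_
    rw [Finset.sum_mul]
    refine Finset.sum_congr rfl fun i _ => ?_
    rw [Finset.mul_sum]
    refine Finset.sum_congr rfl fun l _ => ?_
    rw [Finset.mul_sum, Finset.mul_sum]
    refine Finset.sum_congr rfl fun j _ => ?_
    ring
  have hi : ∀ x y : Fin s × Fin n, Integrable (fun p =>
      (v x.1 x.2 * v y.1 y.2) * (E p y.2 x.2 * Φ y.1 p * Φ x.1 p)) μ :=
    fun x y => (hint y.1 x.1 y.2 x.2).const_mul _
  rw [integral_const_mul]
  simp only [key]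
  rw [integral_finsetSum _ fun x _ => integrable_finsetSum _ fun y _ => hi x y]
  congr 1
  simp only [dotProduct, mulVec, transpose_apply]
  refine Finset.sum_congr rfl fun x _ => ?_
  rw [integral_finsetSum _ fun y _ => hi x y, Finset.mul_sum]
  refine Finset.sum_congr rfl fun y _ => ?_
  rw [integral_const_mul, ← hEhat]
  ring
end
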